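/- arXiv:2402.15188 — 2 statements merged into one kernel-verified Lean document; each statement's English description precedes it below -/
import Mathlib

section
/- Suppose θ_PO ∈ Θ satisfies PR(θ_PO) ≤ PR(θ) for all θ ∈ Θ (a performatively optimal decision). Let h ≥ 1 be an integer, let P ⊆ Θ with ‖x − y‖ ≤ √D · 2^{−(h−1)} for all x, y ∈ P, let C ⊆ P be a set containing θ_PO, let θ_par ∈ P, and let θ_rep ∈ C satisfy DPR(θ_par, θ_rep) ≤ DPR(θ_par, θ) for all θ ∈ C. If θ_T ∈ Θ satisfies PR(θ_T) ≤ PR(θ_rep), then the simple regret obeys PR(θ_T) − PR(θ_PO) ≤ 2·(2√D)^α · L_z · ε · 2^{−αh}. (This is the regret bound for the DOOP algorithm with h = ⊥_{h_max} + 1, where ⊥_{h_max} is the depth of the deepest opened cell containing θ_PO.) -/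
open MeasureTheory

/-- The performative risk `PR(θ) = E_{z ∼ 𝒟(θ)}[f(θ, z)]`. -/
noncomputable def PR {D : ℕ} {Z : Type*} [MeasurableSpace Z]
    (f : EuclideanSpace ℝ (Fin D) → Z → ℝ)
    (𝒟 : EuclideanSpace ℝ (Fin D) → Measure Z)
    (θ : EuclideanSpace ℝ (Fin D)) : ℝ :=
  ∫ z, f θ z ∂(𝒟 θ)

/-- The decoupled performative risk `DPR(θ, θ') = E_{z ∼ 𝒟(θ)}[f(θ', z)]`. -/
noncomputable def DPR {D : ℕ} {Z : Type*} [MeasurableSpace Z]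
    (f : EuclideanSpace ℝ (Fin D) → Z → ℝ)
    (𝒟 : EuclideanSpace ℝ (Fin D) → Measure Z)
    (θ θ' : EuclideanSpace ℝ (Fin D)) : ℝ :=
  ∫ z, f θ' z ∂(𝒟 θ)

/-- A transport bound `|∫ g ∂μ - ∫ g ∂ν| ≤ c` for 1-Lipschitz `g` scales to `L`-Lipschitz
functions. -/
theorem abs_integral_sub_integral_le_of_lipschitz {Z : Type*} [MeasurableSpace Z] [MetricSpace Z]
    {μ ν : Measure Z} {c L : ℝ} (hL : 0 < L)
    (hdual : ∀ g : Z → ℝ, (∀ z z' : Z, |g z - g z'| ≤ dist z z') →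
      Integrable g μ → Integrable g ν → |(∫ z, g z ∂μ) - ∫ z, g z ∂ν| ≤ c)
    {g : Z → ℝ} (hg : ∀ z z' : Z, |g z - g z'| ≤ L * dist z z')
    (hμ : Integrable g μ) (hν : Integrable g ν) :
    |(∫ z, g z ∂μ) - ∫ z, g z ∂ν| ≤ L * c := by
  have hscaled := hdual (fun z => L⁻¹ * g z)
    (fun z z' => by
      rw [← mul_sub, abs_mul, abs_of_pos (inv_pos.mpr hL), inv_mul_le_iff₀ hL]
      exact hg z z')
    (hμ.const_mul _) (hν.const_mul _)
  rwa [integral_const_mul, integral_const_mul, ← mul_sub, abs_mul,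
    abs_of_pos (inv_pos.mpr hL), inv_mul_le_iff₀ hL] at hscaled

/-- Simple-regret bound for DOOP: if `θ_PO` is performatively optimal, `θ_PO ∈ C ⊆ P` where the
parent cell `P` has diameter at most `√D·2^{−(h−1)}`, `θ_rep` minimizes `DPR(θ_par, ·)` over `C`,
and `PR(θ_T) ≤ PR(θ_rep)`, then `PR(θ_T) − PR(θ_PO) ≤ 2·(2√D)^α · L_z · ε · 2^{−αh}`. -/
theorem stmt5 {D : ℕ} (hD : 1 ≤ D)
    {Z : Type*} [MeasurableSpace Z] [MetricSpace Z]
    (Θ : Set (EuclideanSpace ℝ (Fin D))) (hΘ : Θ.Nonempty)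
    (f : EuclideanSpace ℝ (Fin D) → Z → ℝ)
    (𝒟 : EuclideanSpace ℝ (Fin D) → Measure Z)
    (hprob : ∀ θ, IsProbabilityMeasure (𝒟 θ))
    (hint : ∀ θ ∈ Θ, ∀ θ' ∈ Θ, Integrable (f θ') (𝒟 θ))
    {ε α Lz : ℝ} (hε : 0 < ε) (hα : 0 < α) (hLz : 0 < Lz)
    (hsens : ∀ θ ∈ Θ, ∀ θ' ∈ Θ, ∀ g : Z → ℝ,
      (∀ z z' : Z, |g z - g z'| ≤ dist z z') →
      Integrable g (𝒟 θ) → Integrable g (𝒟 θ') →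
      |(∫ z, g z ∂(𝒟 θ)) - ∫ z, g z ∂(𝒟 θ')| ≤ ε * ‖θ - θ'‖ ^ α)
    (hlip : ∀ θ ∈ Θ, ∀ z z' : Z, |f θ z - f θ z'| ≤ Lz * dist z z')
    (θPO : EuclideanSpace ℝ (Fin D)) (hθPO : θPO ∈ Θ)
    (hopt : ∀ θ ∈ Θ, PR f 𝒟 θPO ≤ PR f 𝒟 θ)
    (h : ℕ) (hh : 1 ≤ h)
    (P : Set (EuclideanSpace ℝ (Fin D))) (hPΘ : P ⊆ Θ)
    (hdiam : ∀ x ∈ P, ∀ y ∈ P, ‖x - y‖ ≤ Real.sqrt D * (2 : ℝ) ^ (-((h : ℝ) - 1)))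
    (C : Set (EuclideanSpace ℝ (Fin D))) (hCP : C ⊆ P) (hPOC : θPO ∈ C)
    (θpar : EuclideanSpace ℝ (Fin D)) (hθpar : θpar ∈ P)
    (θrep : EuclideanSpace ℝ (Fin D)) (hθrep : θrep ∈ C)
    (hmin : ∀ θ ∈ C, DPR f 𝒟 θpar θrep ≤ DPR f 𝒟 θpar θ)
    (θT : EuclideanSpace ℝ (Fin D)) (hθT : θT ∈ Θ)
    (hT : PR f 𝒟 θT ≤ PR f 𝒟 θrep) :
    PR f 𝒟 θT - PR f 𝒟 θPO ≤
      2 * (2 * Real.sqrt D) ^ α * Lz * ε * (2 : ℝ) ^ (-(α * h)) := by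
  have gap : ∀ θ ∈ P, |PR f 𝒟 θ - DPR f 𝒟 θpar θ| ≤
      (2 * Real.sqrt D) ^ α * Lz * ε * (2 : ℝ) ^ (-(α * h)) := fun θ hθ =>
    calc |PR f 𝒟 θ - DPR f 𝒟 θpar θ|
        ≤ Lz * (ε * ‖θ - θpar‖ ^ α) :=
          abs_integral_sub_integral_le_of_lipschitz hLz
            (hsens θ (hPΘ hθ) θpar (hPΘ hθpar)) (hlip θ (hPΘ hθ))
            (hint θ (hPΘ hθ) θ (hPΘ hθ)) (hint θpar (hPΘ hθpar) θ (hPΘ hθ))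
      _ ≤ Lz * (ε * (Real.sqrt D * (2 : ℝ) ^ (-((h : ℝ) - 1))) ^ α) := by
          gcongr
          exact hdiam θ hθ θpar hθpar
      _ = (2 * Real.sqrt D) ^ α * Lz * ε * (2 : ℝ) ^ (-(α * h)) := by
          have hcell : Real.sqrt D * (2 : ℝ) ^ (-((h : ℝ) - 1)) =
              2 * Real.sqrt D * (2 : ℝ) ^ (-(h : ℝ)) := by
            rw [show -((h : ℝ) - 1) = -(h : ℝ) + 1 by ring,
              Real.rpow_add_one two_ne_zero]
            ring
          rw [hcell, Real.mul_rpow (by positivity) (by positivity),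
            ← Real.rpow_mul zero_le_two, show -(h : ℝ) * α = -(α * h) by ring]
          ring
  have hrep := (abs_le.mp (gap θrep (hCP hθrep))).2
  have hPO := (abs_le.mp (gap θPO (hCP hPOC))).1
  linarith [hmin θPO hPOC]
end

section
/- (Regret bound for the SOOP algorithm under the clean event, stated with the clean-event estimates as hypotheses.) Suppose θ_PO ∈ Θ satisfies PR(θ_PO) ≤ PR(θ) for all θ ∈ Θ. Let h ≥ 1 be an integer, let P ⊆ Θ with ‖x − y‖ ≤ √D · 2^{−(h−1)} for all x, y ∈ P, let C ⊆ P contain θ_PO, and let θ_par ∈ P. Let β₁, β₂ ≥ 0, let g : C → ℝ satisfy |g(θ) − DPR(θ_par, θ)| ≤ β₁ for all θ ∈ C, and let θ̂ ∈ C satisfy g(θ̂) ≤ g(θ) for all θ ∈ C. Let θ_c, θ_T ∈ Θ and real numbers p̂(θ̂), p̂(θ_c), q(θ_c), q(θ_T) (empirical risk estimates) satisfy: |p̂(θ̂) − PR(θ̂)| ≤ β₁, |p̂(θ_c) − PR(θ_c)| ≤ β₁, p̂(θ_c) ≤ p̂(θ̂), |q(θ_c) − PR(θ_c)| ≤ β₂,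 |q(θ_T) − PR(θ_T)| ≤ β₂, and q(θ_T) ≤ q(θ_c). Then PR(θ_T) − PR(θ_PO) ≤ 2·(2√D)^α · L_z · ε · 2^{−αh} + 4β₁ + 2β₂. -/
open MeasureTheory

/-- An `L`-Lipschitz test function inherits the sensitivity bound of the distribution map, scaled
by `L`. -/
theorem abs_integral_sub_le_of_lipschitz {Z : Type*} [MeasurableSpace Z] [MetricSpace Z]
    {μ ν : Measure Z} {L B : ℝ} (hL : 0 < L)
    (hB : ∀ g : Z → ℝ, (∀ z z' : Z, |g z - g z'| ≤ dist z z') →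
      Integrable g μ → Integrable g ν → |(∫ z, g z ∂μ) - ∫ z, g z ∂ν| ≤ B)
    {φ : Z → ℝ} (hφ : ∀ z z' : Z, |φ z - φ z'| ≤ L * dist z z')
    (hμ : Integrable φ μ) (hν : Integrable φ ν) :
    |(∫ z, φ z ∂μ) - ∫ z, φ z ∂ν| ≤ L * B := by
  have key := hB (fun z => L⁻¹ * φ z) (fun z z' => ?_) (hμ.const_mul _) (hν.const_mul _)
  · rwa [integral_const_mul, integral_const_mul, ← mul_sub, abs_mul,
      abs_of_pos (inv_pos.mpr hL), inv_mul_le_iff₀ hL] at key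
  · rw [← mul_sub, abs_mul, abs_of_pos (inv_pos.mpr hL), inv_mul_le_iff₀ hL]
    exact hφ z z'

/-- The `α`-th power of the diameter of a depth-`h` cell. -/
theorem mul_two_rpow_neg_sub_one_rpow {r : ℝ} (hr : 0 ≤ r) (h α : ℝ) :
    (r * (2 : ℝ) ^ (-(h - 1))) ^ α = (2 * r) ^ α * (2 : ℝ) ^ (-(α * h)) := by
  have hsplit : r * (2 : ℝ) ^ (-(h - 1)) = (2 * r) * (2 : ℝ) ^ (-h) := by
    rw [show -(h - 1) = 1 + -h by ring, Real.rpow_add two_pos, Real.rpow_one]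
    ring
  rw [hsplit, Real.mul_rpow (by positivity) (by positivity), ← Real.rpow_mul two_pos.le]
  congr 2
  ring

/-- Regret bound for SOOP under the clean event (clean-event estimates as hypotheses):
`PR(θ_T) − PR(θ_PO) ≤ 2·(2√D)^α · L_z · ε · 2^{−αh} + 4β₁ + 2β₂`. -/
theorem stmt7 {D : ℕ} (hD : 1 ≤ D)
    {Z : Type*} [MeasurableSpace Z] [MetricSpace Z]
    (Θ : Set (EuclideanSpace ℝ (Fin D))) (hΘ : Θ.Nonempty)
    (f : EuclideanSpace ℝ (Fin D) → Z → ℝ)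
    (𝒟 : EuclideanSpace ℝ (Fin D) → Measure Z)
    (hprob : ∀ θ, IsProbabilityMeasure (𝒟 θ))
    (hint : ∀ θ ∈ Θ, ∀ θ' ∈ Θ, Integrable (f θ') (𝒟 θ))
    {ε α Lz : ℝ} (hε : 0 < ε) (hα : 0 < α) (hLz : 0 < Lz)
    (hsens : ∀ θ ∈ Θ, ∀ θ' ∈ Θ, ∀ g : Z → ℝ,
      (∀ z z' : Z, |g z - g z'| ≤ dist z z') →
      Integrable g (𝒟 θ) → Integrable g (𝒟 θ') →
      |(∫ z, g z ∂(𝒟 θ)) - ∫ z, g z ∂(𝒟 θ')| ≤ ε * ‖θ - θ'‖ ^ α)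
    (hlip : ∀ θ ∈ Θ, ∀ z z' : Z, |f θ z - f θ z'| ≤ Lz * dist z z')
    (θPO : EuclideanSpace ℝ (Fin D)) (hθPO : θPO ∈ Θ)
    (hopt : ∀ θ ∈ Θ, PR f 𝒟 θPO ≤ PR f 𝒟 θ)
    (h : ℕ) (hh : 1 ≤ h)
    (P : Set (EuclideanSpace ℝ (Fin D))) (hPΘ : P ⊆ Θ)
    (hdiam : ∀ x ∈ P, ∀ y ∈ P, ‖x - y‖ ≤ Real.sqrt D * (2 : ℝ) ^ (-((h : ℝ) - 1)))
    (C : Set (EuclideanSpace ℝ (Fin D))) (hCP : C ⊆ P) (hPOC : θPO ∈ C)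
    (θpar : EuclideanSpace ℝ (Fin D)) (hθpar : θpar ∈ P)
    {β₁ β₂ : ℝ} (hβ₁ : 0 ≤ β₁) (hβ₂ : 0 ≤ β₂)
    (g : EuclideanSpace ℝ (Fin D) → ℝ)
    (hg : ∀ θ ∈ C, |g θ - DPR f 𝒟 θpar θ| ≤ β₁)
    (θhat : EuclideanSpace ℝ (Fin D)) (hθhat : θhat ∈ C)
    (hmin : ∀ θ ∈ C, g θhat ≤ g θ)
    (θc θT : EuclideanSpace ℝ (Fin D)) (hθc : θc ∈ Θ) (hθT : θT ∈ Θ)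
    (phat_hat phat_c q_c q_T : ℝ)
    (h1 : |phat_hat - PR f 𝒟 θhat| ≤ β₁)
    (h2 : |phat_c - PR f 𝒟 θc| ≤ β₁)
    (h3 : phat_c ≤ phat_hat)
    (h4 : |q_c - PR f 𝒟 θc| ≤ β₂)
    (h5 : |q_T - PR f 𝒟 θT| ≤ β₂)
    (h6 : q_T ≤ q_c) :
    PR f 𝒟 θT - PR f 𝒟 θPO ≤
      2 * (2 * Real.sqrt D) ^ α * Lz * ε * (2 : ℝ) ^ (-(α * h))
        + 4 * β₁ + 2 * β₂ := by
  have hdev : ∀ θ ∈ C, |PR f 𝒟 θ - DPR f 𝒟 θpar θ| ≤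
      Lz * (ε * ((2 * Real.sqrt D) ^ α * (2 : ℝ) ^ (-(α * h)))) := by
    intro θ hθ
    have hθΘ := hPΘ (hCP hθ)
    have hparΘ := hPΘ hθpar
    refine (abs_integral_sub_le_of_lipschitz hLz (hsens θ hθΘ θpar hparΘ) (hlip θ hθΘ)
      (hint θ hθΘ θ hθΘ) (hint θpar hparΘ θ hθΘ)).trans ?_
    rw [← mul_two_rpow_neg_sub_one_rpow (Real.sqrt_nonneg D)]
    gcongr
    exact hdiam θ (hCP hθ) θpar hθpar
  have hdev_hat := abs_le.mp (hdev θhat hθhat)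
  have hdev_PO := abs_le.mp (hdev θPO hPOC)
  have hg_hat := abs_le.mp (hg θhat hθhat)
  have hg_PO := abs_le.mp (hg θPO hPOC)
  have hle := hmin θPO hPOC
  rw [abs_le] at h1 h2 h4 h5
  linarith
end
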